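/- arXiv:1205.2051 — 2 statements merged into one kernel-verified Lean document; each statement's English description precedes it below -/
import Mathlib

section
/- The problem classes SB, MB, SV, and VVc are pairwise distinct where indicated, and form a strict linear order: SB ⊊ MB = VB ⊊ SV = MV = VV ⊊ VVc. -/
namespace Weak

/-- The degree of a vertex. -/
noncomputable def deg {n : ℕ} (G : SimpleGraph (Fin n)) (v : Fin n) : ℕ :=
  Nat.card {u : Fin n // G.Adj v u}

/-- A port of a graph: a pair (v, i) with i ∈ [deg v]. -/
abbrev Port {n : ℕ} (G : SimpleGraph (Fin n)) : Type := Σ v : Fin n, Fin (deg G v)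

/-- A port numbering: a bijection on ports with A(p) = A(G). -/
structure PortNumbering {n : ℕ} (G : SimpleGraph (Fin n)) where
  p : Port G ≃ Port G
  adj : ∀ u v : Fin n, (∃ i : Fin (deg G u), (p ⟨u, i⟩).1 = v) ↔ G.Adj u v

/-- A consistent port numbering is an involution. -/
def PortNumbering.Consistent {n : ℕ} {G : SimpleGraph (Fin n)} (pn : PortNumbering G) : Prop :=
  ∀ q : Port G, pn.p (pn.p q) = q

/-- A distributed state machine for F(Δ), with stopping states Y. -/
structure DSM (Y : Type) (Δ : ℕ) where
  Z : Type
  z₀ : Fin (Δ + 1) → Y ⊕ Z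
  M : Type
  m₀ : M
  μ : Z → Fin Δ → M
  δ : Z → (Fin Δ → M) → Y ⊕ Z

namespace DSM

variable {Y : Type} {Δ : ℕ}

/-- μ extended to stopping states: a stopped node sends the dummy message. -/
def μ' (A : DSM Y Δ) : Y ⊕ A.Z → Fin Δ → A.M
  | Sum.inl _ => fun _ => A.m₀
  | Sum.inr z => A.μ z

/-- δ extended to stopping states: a stopped node no longer changes state. -/
def δ' (A : DSM Y Δ) : Y ⊕ A.Z → (Fin Δ → A.M) → Y ⊕ A.Z
  | Sum.inl y, _ => Sum.inl y
  | Sum.inr z, m => A.δ z m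

/-- Machines whose transition depends only on the multiset of received messages. -/
def InMultiset (A : DSM Y Δ) : Prop :=
  ∀ (z : A.Z) (a b : Fin Δ → A.M),
    (List.ofFn a : Multiset A.M) = (List.ofFn b : Multiset A.M) → A.δ z a = A.δ z b

/-- Machines whose transition depends only on the set of received messages. -/
def InSet (A : DSM Y Δ) : Prop :=
  ∀ (z : A.Z) (a b : Fin Δ → A.M), Set.range a = Set.range b → A.δ z a = A.δ z b

/-- Machines that send the same message to all ports. -/
def InBroadcast (A : DSM Y Δ) : Prop :=
  ∀ (z : A.Z) (i j : Fin Δ), A.μ z i = A.μ z j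

end DSM

/-- The execution of a machine in (G, p): the state of node u at time t. -/
noncomputable def exec {Y : Type} {Δ n : ℕ} (A : DSM Y Δ) (G : SimpleGraph (Fin n))
    (hG : ∀ v, deg G v ≤ Δ) (pn : PortNumbering G) : ℕ → Fin n → Y ⊕ A.Z
  | 0, u => A.z₀ ⟨deg G u, Nat.lt_succ_of_le (hG u)⟩
  | t + 1, u =>
      A.δ' (exec A G hG pn t u) fun k =>
        if h : (k : ℕ) < deg G u then
          A.μ' (exec A G hG pn t (pn.p.symm ⟨u, ⟨(k : ℕ), h⟩⟩).1)
            ⟨((pn.p.symm ⟨u, ⟨(k : ℕ), h⟩⟩).2 : ℕ),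
              lt_of_lt_of_le (pn.p.symm ⟨u, ⟨(k : ℕ), h⟩⟩).2.isLt (hG _)⟩
        else A.m₀

/-- A graph problem: for each graph, a set of admissible outputs. -/
abbrev GraphProblem (Y : Type) : Type :=
  ∀ n : ℕ, SimpleGraph (Fin n) → Set ((Fin n) → Y)

/-- A sequence of machines solves a problem in time T. -/
def SolvesInTime {Y : Type} (A : ∀ Δ : ℕ, DSM Y Δ) (P : GraphProblem Y)
    (T : ℕ → ℕ → ℕ) : Prop :=
  ∀ (Δ n : ℕ) (G : SimpleGraph (Fin n)) (hG : ∀ v, deg G v ≤ Δ) (pn : PortNumbering G),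
    ∃ S ∈ P n G, ∀ u, exec (A Δ) G hG pn (T Δ n) u = Sum.inl (S u)

/-- A sequence of machines solves a problem in time T assuming consistency. -/
def SolvesInTimeConsistent {Y : Type} (A : ∀ Δ : ℕ, DSM Y Δ) (P : GraphProblem Y)
    (T : ℕ → ℕ → ℕ) : Prop :=
  ∀ (Δ n : ℕ) (G : SimpleGraph (Fin n)) (hG : ∀ v, deg G v ≤ Δ) (pn : PortNumbering G),
    pn.Consistent →
    ∃ S ∈ P n G, ∀ u, exec (A Δ) G hG pn (T Δ n) u = Sum.inl (S u)

/-- Problem class VV. -/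
def VV {Y : Type} (P : GraphProblem Y) : Prop :=
  ∃ A : ∀ Δ : ℕ, DSM Y Δ, ∃ T, SolvesInTime A P T

/-- Problem class MV. -/
def MV {Y : Type} (P : GraphProblem Y) : Prop :=
  ∃ A : ∀ Δ : ℕ, DSM Y Δ, (∀ Δ, (A Δ).InMultiset) ∧ ∃ T, SolvesInTime A P T

/-- Problem class SV. -/
def SV {Y : Type} (P : GraphProblem Y) : Prop :=
  ∃ A : ∀ Δ : ℕ, DSM Y Δ, (∀ Δ, (A Δ).InSet) ∧ ∃ T, SolvesInTime A P T

/-- Problem class VB. -/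
def VB {Y : Type} (P : GraphProblem Y) : Prop :=
  ∃ A : ∀ Δ : ℕ, DSM Y Δ, (∀ Δ, (A Δ).InBroadcast) ∧ ∃ T, SolvesInTime A P T

/-- Problem class MB. -/
def MB {Y : Type} (P : GraphProblem Y) : Prop :=
  ∃ A : ∀ Δ : ℕ, DSM Y Δ, (∀ Δ, (A Δ).InMultiset ∧ (A Δ).InBroadcast) ∧ ∃ T, SolvesInTime A P T

/-- Problem class SB. -/
def SB {Y : Type} (P : GraphProblem Y) : Prop :=
  ∃ A : ∀ Δ : ℕ, DSM Y Δ, (∀ Δ, (A Δ).InSet ∧ (A Δ).InBroadcast) ∧ ∃ T, SolvesInTime A P T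

/-- Problem class VVc. -/
def VVc {Y : Type} (P : GraphProblem Y) : Prop :=
  ∃ A : ∀ Δ : ℕ, DSM Y Δ, ∃ T, SolvesInTimeConsistent A P T

/-- Constant-time problem class VV(1). -/
def VV1 {Y : Type} (P : GraphProblem Y) : Prop :=
  ∃ A : ∀ Δ : ℕ, DSM Y Δ, ∃ T' : ℕ → ℕ, SolvesInTime A P fun Δ _ => T' Δ

/-- Constant-time problem class MV(1). -/
def MV1 {Y : Type} (P : GraphProblem Y) : Prop :=
  ∃ A : ∀ Δ : ℕ, DSM Y Δ, (∀ Δ, (A Δ).InMultiset) ∧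
    ∃ T' : ℕ → ℕ, SolvesInTime A P fun Δ _ => T' Δ

/-- Constant-time problem class SV(1). -/
def SV1 {Y : Type} (P : GraphProblem Y) : Prop :=
  ∃ A : ∀ Δ : ℕ, DSM Y Δ, (∀ Δ, (A Δ).InSet) ∧
    ∃ T' : ℕ → ℕ, SolvesInTime A P fun Δ _ => T' Δ

/-- Constant-time problem class VB(1). -/
def VB1 {Y : Type} (P : GraphProblem Y) : Prop :=
  ∃ A : ∀ Δ : ℕ, DSM Y Δ, (∀ Δ, (A Δ).InBroadcast) ∧
    ∃ T' : ℕ → ℕ, SolvesInTime A P fun Δ _ => T' Δ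

/-- Constant-time problem class MB(1). -/
def MB1 {Y : Type} (P : GraphProblem Y) : Prop :=
  ∃ A : ∀ Δ : ℕ, DSM Y Δ, (∀ Δ, (A Δ).InMultiset ∧ (A Δ).InBroadcast) ∧
    ∃ T' : ℕ → ℕ, SolvesInTime A P fun Δ _ => T' Δ

/-- Constant-time problem class SB(1). -/
def SB1 {Y : Type} (P : GraphProblem Y) : Prop :=
  ∃ A : ∀ Δ : ℕ, DSM Y Δ, (∀ Δ, (A Δ).InSet ∧ (A Δ).InBroadcast) ∧
    ∃ T' : ℕ → ℕ, SolvesInTime A P fun Δ _ => T' Δ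

/-- Constant-time problem class VVc(1). -/
def VVc1 {Y : Type} (P : GraphProblem Y) : Prop :=
  ∃ A : ∀ Δ : ℕ, DSM Y Δ, ∃ T' : ℕ → ℕ, SolvesInTimeConsistent A P fun Δ _ => T' Δ

end Weak

namespace Weak

section Ports

variable {n : ℕ} {G : SimpleGraph (Fin n)}

namespace PortNumbering

/-- The port from which the message arriving at the `k`-th port of `u` was sent. -/
def source (pn : PortNumbering G) (u : Fin n) (k : Fin (deg G u)) : Port G :=
  pn.p.symm ⟨u, k⟩

variable (pn : PortNumbering G)

theorem p_source (u : Fin n) (k : Fin (deg G u)) : pn.p (pn.source u k) = ⟨u, k⟩ :=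
  pn.p.apply_symm_apply _

theorem source_eq_of_p_eq {q : Port G} {u : Fin n} {k : Fin (deg G u)}
    (h : pn.p q = ⟨u, k⟩) : pn.source u k = q :=
  pn.p.symm_apply_eq.2 h.symm

theorem exists_source_eq {q : Port G} {u : Fin n} (h : (pn.p q).1 = u) :
    ∃ k, pn.source u k = q := by
  subst h
  exact ⟨(pn.p q).2, pn.source_eq_of_p_eq rfl⟩

theorem adj_source (u : Fin n) (k : Fin (deg G u)) : G.Adj u (pn.source u k).1 :=
  ((pn.adj _ u).1 ⟨(pn.source u k).2, congrArg Sigma.fst (pn.p_source u k)⟩).symm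

theorem source_bijective (u : Fin n) :
    Function.Bijective fun k : Fin (deg G u) =>
      (⟨(pn.source u k).1, pn.adj_source u k⟩ : {v // G.Adj u v}) := by
  refine Function.Surjective.bijective_of_nat_card_le ?_ (by simp [deg])
  rintro ⟨v, hv⟩
  obtain ⟨i, hi⟩ := (pn.adj v u).2 hv.symm
  obtain ⟨k, hk⟩ := pn.exists_source_eq hi
  exact ⟨k, Subtype.ext (congrArg Sigma.fst hk)⟩

theorem source_injective {u : Fin n} {k l : Fin (deg G u)}
    (h : (pn.source u k).1 = (pn.source u l).1) : k = l :=
  (pn.source_bijective u).1 (Subtype.ext h)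

theorem exists_target_eq {u v : Fin n} (h : G.Adj u v) : ∃ i, (pn.p ⟨u, i⟩).1 = v :=
  (pn.adj u v).2 h

theorem exists_source_fst_eq {u v : Fin n} (h : G.Adj u v) : ∃ k, (pn.source u k).1 = v := by
  obtain ⟨k, hk⟩ := (pn.source_bijective u).2 ⟨v, h⟩
  exact ⟨k, congrArg Subtype.val hk⟩

/-- Renumber the receiving side of the ports of each node. -/
def permute (σ : ∀ u, Equiv.Perm (Fin (deg G u))) : PortNumbering G where
  p := pn.p.trans (Equiv.sigmaCongrRight fun u => (σ u).symm)
  adj := pn.adj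

theorem source_permute (σ : ∀ u, Equiv.Perm (Fin (deg G u))) (u : Fin n) (k : Fin (deg G u)) :
    (pn.permute σ).source u k = pn.source u (σ u k) := by
  apply source_eq_of_p_eq
  change Equiv.sigmaCongrRight (fun u => (σ u).symm) (pn.p (pn.source u (σ u k))) = _
  rw [p_source]
  simp

end PortNumbering

/-- Reversing the arcs of a graph. -/
def arcSwap (G : SimpleGraph (Fin n)) :
    (Σ u : Fin n, {v // G.Adj u v}) ≃ (Σ u : Fin n, {v // G.Adj u v}) where
  toFun q := ⟨q.2.1, q.1, q.2.2.symm⟩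
  invFun q := ⟨q.2.1, q.1, q.2.2.symm⟩
  left_inv _ := rfl
  right_inv _ := rfl

instance : Nonempty (PortNumbering G) := by
  let e : ∀ u, Fin (deg G u) ≃ {v // G.Adj u v} := fun u => (Finite.equivFin _).symm
  refine ⟨⟨((Equiv.sigmaCongrRight e).trans (arcSwap G)).trans (Equiv.sigmaCongrRight e).symm,
    fun u v => ⟨?_, fun h => ⟨(e u).symm ⟨v, h⟩, ?_⟩⟩⟩⟩
  · rintro ⟨i, rfl⟩
    exact (e u i).2
  · change ((e u) ((e u).symm ⟨v, h⟩)).1 = v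
    simp

/-- Collect at `u`, in the order of its ports, the values that `f` assigns to the sending ports;
the missing ports are padded with `c`. -/
noncomputable def gather {α : Type*} (pn : PortNumbering G) (Δ : ℕ) (c : α) (f : Port G → α)
    (u : Fin n) : Fin Δ → α :=
  fun k => if h : (k : ℕ) < deg G u then f (pn.source u ⟨k, h⟩) else c

section Gather

variable {α : Type*} {Δ : ℕ} {c : α} {f : Port G → α} {u : Fin n}

theorem gather_of_lt (pn : PortNumbering G) {k : Fin Δ} (h : (k : ℕ) < deg G u) :
    gather pn Δ c f u k = f (pn.source u ⟨k, h⟩) :=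
  dif_pos h

theorem gather_of_le (pn : PortNumbering G) {k : Fin Δ} (h : deg G u ≤ k) :
    gather pn Δ c f u k = c :=
  dif_neg h.not_gt

theorem gather_castLE (pn : PortNumbering G) (hu : deg G u ≤ Δ) (k : Fin (deg G u)) :
    gather pn Δ c f u (k.castLE hu) = f (pn.source u k) :=
  gather_of_lt pn k.2

theorem exists_gather_eq (pn : PortNumbering G) (hu : deg G u ≤ Δ) {x : α} (hx : x ≠ c) :
    (∃ k, gather pn Δ c f u k = x) ↔ ∃ k, f (pn.source u k) = x := by
  constructor
  · rintro ⟨k, hk⟩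
    by_cases h : (k : ℕ) < deg G u
    · exact ⟨⟨k, h⟩, by rw [← hk, gather_of_lt pn h]⟩
    · exact absurd (hk.symm.trans (gather_of_le pn (not_lt.1 h))) hx
  · rintro ⟨k, hk⟩
    exact ⟨k.castLE hu, (gather_castLE pn hu k).trans hk⟩

end Gather

end Ports

section Execution

variable {Y : Type} {Δ n : ℕ} {G : SimpleGraph (Fin n)}

/-- The message that the state assignment `x` puts on a port. -/
noncomputable def sent (A : DSM Y Δ) (hG : ∀ v, deg G v ≤ Δ) (x : Fin n → Y ⊕ A.Z)
    (q : Port G) : A.M :=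
  A.μ' (x q.1) (q.2.castLE (hG q.1))

theorem exec_succ (A : DSM Y Δ) (hG : ∀ v, deg G v ≤ Δ) (pn : PortNumbering G) (t : ℕ)
    (u : Fin n) :
    exec A G hG pn (t + 1) u =
      A.δ' (exec A G hG pn t u) (gather pn Δ A.m₀ (sent A hG (exec A G hG pn t)) u) :=
  rfl

theorem exec_eq_inl_of_le (A : DSM Y Δ) (hG : ∀ v, deg G v ≤ Δ) (pn : PortNumbering G)
    {t t' : ℕ} (h : t ≤ t') {u : Fin n} {y : Y} (ht : exec A G hG pn t u = Sum.inl y) :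
    exec A G hG pn t' u = Sum.inl y := by
  induction t', h using Nat.le_induction with
  | base => exact ht
  | succ t' _ ih => rw [exec_succ, ih]; rfl

theorem DSM.InSet.inMultiset {A : DSM Y Δ} (hA : A.InSet) : A.InMultiset := by
  intro z a b h
  apply hA
  ext m
  have := (Multiset.coe_eq_coe.1 h).mem_iff (a := m)
  simpa [List.mem_ofFn] using this

/-- The extended transition of a machine in `Set` depends on the set of messages only. -/
theorem DSM.InSet.δ'_congr {A : DSM Y Δ} (hA : A.InSet) (x : Y ⊕ A.Z) {a b : Fin Δ → A.M}
    (h : Set.range a = Set.range b) : A.δ' x a = A.δ' x b := by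
  cases x with
  | inl y => rfl
  | inr z => exact hA z a b h

theorem DSM.InBroadcast.μ'_congr {A : DSM Y Δ} (hA : A.InBroadcast) (x : Y ⊕ A.Z)
    (i j : Fin Δ) : A.μ' x i = A.μ' x j := by
  cases x with
  | inl y => rfl
  | inr z => exact hA z i j

end Execution

section CountLeaves

open Classical in
/-- Does a node have exactly two neighbours of degree one? -/
noncomputable def twoLeaves : GraphProblem Bool := fun _ G =>
  {S | ∀ v, S v = decide (Nat.card {u // G.Adj v u ∧ deg G u = 1} = 2)}

/-- Every node announces its degree and counts the received ones. -/
def leafCounter (Δ : ℕ) : DSM Bool Δ where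
  Z := ℕ
  z₀ d := Sum.inr d
  M := ℕ
  m₀ := 0
  μ d _ := d
  δ _ a := Sum.inl (decide ((List.ofFn a : Multiset ℕ).count 1 = 2))

theorem count_ofFn {α : Type*} [DecidableEq α] {m : ℕ} (a : Fin m → α) (x : α) :
    (List.ofFn a : Multiset α).count x = Nat.card {k // a k = x} := by
  rw [← Fin.univ_val_map, Multiset.count_map, Nat.card_eq_fintype_card, Fintype.card_subtype]
  simp only [eq_comm, Finset.card, Finset.filter_val]

theorem mb_twoLeaves : MB twoLeaves := by
  refine ⟨leafCounter, fun Δ => ⟨fun z a b h => ?_, fun _ _ _ => rfl⟩, fun _ _ => 1,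
    fun Δ n G hG pn => ⟨_, fun v => rfl, fun v => ?_⟩⟩
  · simp only [leafCounter] at h ⊢
    rw [h]
  · rw [exec_succ]
    change Sum.inl (decide ((List.ofFn (gather pn Δ 0 (fun q => deg G q.1) v) :
      Multiset ℕ).count 1 = 2)) = Sum.inl _
    congr 2
    rw [eq_iff_iff, count_ofFn]
    suffices h : Nat.card {k // gather pn Δ 0 (fun q => deg G q.1) v k = 1} =
        Nat.card {u // G.Adj v u ∧ deg G u = 1} by
      rw [h]
    refine (Nat.card_eq_of_bijective
      (fun u : {k : Fin (deg G v) // deg G (pn.source v k).1 = 1} =>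
        (⟨u.1.castLE (hG v), (gather_castLE pn _ _).trans u.2⟩ :
          {k // gather pn Δ 0 (fun q => deg G q.1) v k = 1})) ⟨?_, ?_⟩).symm.trans
      (Nat.card_eq_of_bijective
      (fun u : {k : Fin (deg G v) // deg G (pn.source v k).1 = 1} =>
        (⟨(pn.source v u.1).1, pn.adj_source _ _, u.2⟩ :
          {u // G.Adj v u ∧ deg G u = 1})) ⟨?_, ?_⟩)
    · rintro ⟨k, _⟩ ⟨l, _⟩ h
      simpa using h
    · rintro ⟨k, hk⟩
      have hlt : (k : ℕ) < deg G v := by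
        by_contra h
        rw [gather_of_le pn (not_lt.1 h)] at hk
        exact zero_ne_one hk
      exact ⟨⟨⟨k, hlt⟩, by rwa [gather_of_lt pn hlt] at hk⟩, rfl⟩
    · rintro ⟨k, _⟩ ⟨l, _⟩ h
      exact Subtype.ext (pn.source_injective (congrArg Subtype.val h))
    · rintro ⟨u, hu, hd⟩
      obtain ⟨k, rfl⟩ := pn.exists_source_fst_eq hu
      exact ⟨⟨k, hd⟩, rfl⟩

/-- A machine in `Set ∩ Broadcast` gives the same state to nodes that have the same degree and the
same set of neighbour classes. -/
theorem exec_eq_of_bisimilar {Y ι : Type} {Δ n : ℕ} {G : SimpleGraph (Fin n)} {A : DSM Y Δ}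
    (hs : A.InSet) (hb : A.InBroadcast) (hG : ∀ v, deg G v ≤ Δ) (pn : PortNumbering G)
    (c : Fin n → ι) (hdeg : ∀ u v, c u = c v → deg G u = deg G v)
    (hc : ∀ u v u', c u = c v → G.Adj u u' → ∃ v', G.Adj v v' ∧ c u' = c v') (t : ℕ) :
    ∀ u v, c u = c v → exec A G hG pn t u = exec A G hG pn t v := by
  induction t with
  | zero =>
    intro u v h
    simp only [exec, hdeg u v h]
  | succ t ih =>
    have key : ∀ u v, c u = c v →
        Set.range (gather pn Δ A.m₀ (sent A hG (exec A G hG pn t)) u) ⊆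
          Set.range (gather pn Δ A.m₀ (sent A hG (exec A G hG pn t)) v) := by
      rintro u v h _ ⟨k, rfl⟩
      by_cases hk : (k : ℕ) < deg G u
      · obtain ⟨v', hv, hcv⟩ := hc u v _ h (pn.adj_source u ⟨k, hk⟩)
        obtain ⟨l, rfl⟩ := pn.exists_source_fst_eq hv
        refine ⟨l.castLE (hG v), ?_⟩
        rw [gather_castLE, gather_of_lt pn hk, sent, sent, ih _ _ hcv]
        exact hb.μ'_congr _ _ _
      · refine ⟨k, ?_⟩
        rw [gather_of_le pn (not_lt.1 hk), gather_of_le pn (hdeg u v h ▸ not_lt.1 hk)]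
    intro u v h
    rw [exec_succ, exec_succ, ih u v h]
    exact hs.δ'_congr _ ((key u v h).antisymm (key v u h.symm))

/-- A path `0 - 1 - 2` with leaves attached so that its nodes have degree three. -/
def caterpillar : SimpleGraph (Fin 8) :=
  SimpleGraph.fromRel fun u v =>
    (u, v) ∈ [(0, 1), (1, 2), (0, 3), (0, 4), (1, 5), (2, 6), (2, 7)]

instance : DecidableRel caterpillar.Adj := fun u v =>
  inferInstanceAs (Decidable (u ≠ v ∧ (_ ∨ _)))

theorem deg_caterpillar (v : Fin 8) : deg caterpillar v = if v.1 < 3 then 3 else 1 := by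
  rw [deg, Nat.card_eq_fintype_card]
  revert v
  decide

theorem not_sb_twoLeaves : ¬ SB twoLeaves := by
  rintro ⟨A, hA, T, h⟩
  obtain ⟨pn⟩ : Nonempty (PortNumbering caterpillar) := inferInstance
  have hG : ∀ v, deg caterpillar v ≤ 3 := fun v => by
    rw [deg_caterpillar]; split <;> norm_num
  obtain ⟨S, hS, hu⟩ := h 3 8 caterpillar hG pn
  have heq := exec_eq_of_bisimilar (hA 3).1 (hA 3).2 hG pn (fun v => decide (v.1 < 3))
    (by simp only [deg_caterpillar]; decide) (by decide) (T 3 8) 0 1 rfl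
  rw [hu, hu, Sum.inl.injEq, hS, hS, decide_eq_decide] at heq
  simp only [deg_caterpillar, Nat.card_eq_fintype_card] at heq
  revert heq
  decide

end CountLeaves

section ElectLeaf

/-- Break the symmetry between the two leaves of a path with three nodes. -/
def electLeaf : GraphProblem Bool := fun _ G =>
  {S | ∀ c l l', l ≠ l' → deg G c = 2 → deg G l = 1 → deg G l' = 1 → G.Adj c l → G.Adj c l' →
    S l ≠ S l'}

/-- Every node sends `i` to its `i`-th port, and checks whether it received a `1`. -/
def portSender (Δ : ℕ) : DSM Bool Δ where
  Z := Unit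
  z₀ _ := Sum.inr ()
  M := ℕ
  m₀ := 0
  μ _ i := i
  δ _ a := Sum.inl (decide (∃ k, a k = 1))

theorem exists_source_snd_iff {n : ℕ} {G : SimpleGraph (Fin n)} (pn : PortNumbering G)
    {c l : Fin n} (hl : deg G l = 1) {i : Fin (deg G c)} (hi : (pn.p ⟨c, i⟩).1 = l) (j : ℕ) :
    (∃ k, ((pn.source l k).2 : ℕ) = j) ↔ (i : ℕ) = j := by
  obtain ⟨k, hk⟩ := pn.exists_source_eq hi
  constructor
  · rintro ⟨k', rfl⟩
    have : k' = k := Fin.ext (by omega)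
    rw [this, hk]
  · rintro rfl
    exact ⟨k, by rw [hk]⟩

theorem sv_electLeaf : SV electLeaf := by
  refine ⟨portSender, fun Δ z a b h => ?_, fun _ _ => 1,
    fun Δ n G hG pn => ⟨fun v => decide (∃ k, ((pn.source v k).2 : ℕ) = 1), ?_, fun v => ?_⟩⟩
  · exact congrArg Sum.inl (decide_eq_decide.2 (Set.ext_iff.1 h (1 : ℕ)))
  · intro c l l' hne hc hl hl' ha ha'
    obtain ⟨i, hi⟩ := pn.exists_target_eq ha
    obtain ⟨i', hi'⟩ := pn.exists_target_eq ha'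
    rw [Ne, decide_eq_decide, exists_source_snd_iff pn hl hi, exists_source_snd_iff pn hl' hi']
    have hii : (i : ℕ) ≠ i' := fun h => hne (by rw [← hi, ← hi', Fin.ext h])
    omega
  · rw [exec_succ]
    change Sum.inl (decide (∃ k, gather pn Δ 0 (fun q => (q.2 : ℕ)) v k = 1)) = Sum.inl _
    exact congrArg Sum.inl (decide_eq_decide.2 (exists_gather_eq pn (hG v) one_ne_zero))

/-- A broadcasting machine cannot distinguish two nodes with the same only neighbour. -/
theorem exec_eq_of_unique_neighbor {Y : Type} {Δ n : ℕ} {G : SimpleGraph (Fin n)} {A : DSM Y Δ}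
    (hb : A.InBroadcast) (hG : ∀ v, deg G v ≤ Δ) (pn : PortNumbering G) {c l l' : Fin n}
    (hdeg : deg G l = deg G l') (hl : ∀ v, G.Adj l v → v = c) (hl' : ∀ v, G.Adj l' v → v = c)
    (t : ℕ) : exec A G hG pn t l = exec A G hG pn t l' := by
  induction t with
  | zero => simp only [exec, hdeg]
  | succ t ih =>
    rw [exec_succ, exec_succ, ih]
    congr 1
    funext k
    by_cases hk : (k : ℕ) < deg G l
    · rw [gather_of_lt pn hk, gather_of_lt pn (hdeg ▸ hk), sent, sent]
      simp only [hl _ (pn.adj_source l _), hl' _ (pn.adj_source l' _)]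
      exact hb.μ'_congr _ _ _
    · rw [gather_of_le pn (not_lt.1 hk), gather_of_le pn (hdeg ▸ not_lt.1 hk)]

/-- The path `1 - 0 - 2`. -/
def cherry : SimpleGraph (Fin 3) := SimpleGraph.fromRel fun u _ => u = 0

instance : DecidableRel cherry.Adj := fun u v =>
  inferInstanceAs (Decidable (u ≠ v ∧ (_ ∨ _)))

theorem deg_cherry (v : Fin 3) : deg cherry v = if v = 0 then 2 else 1 := by
  rw [deg, Nat.card_eq_fintype_card]
  revert v
  decide

theorem not_vb_electLeaf : ¬ VB electLeaf := by
  rintro ⟨A, hA, T, h⟩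
  obtain ⟨pn⟩ : Nonempty (PortNumbering cherry) := inferInstance
  have hG : ∀ v, deg cherry v ≤ 2 := fun v => by
    rw [deg_cherry]; split <;> norm_num
  obtain ⟨S, hS, hu⟩ := h 2 3 cherry hG pn
  have heq := exec_eq_of_unique_neighbor (hA 2) hG pn (c := 0) (l := 1) (l' := 2)
    (by simp [deg_cherry]) (by decide) (by decide) (T 2 3)
  rw [hu, hu, Sum.inl.injEq] at heq
  exact hS 0 1 2 (by decide) (by simp [deg_cherry]) (by simp [deg_cherry]) (by simp [deg_cherry])
    (by decide) (by decide) heq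

end ElectLeaf

section CubicSymmetry

/-- Break the symmetry in cubic graphs without a perfect matching. -/
def breakCubicSymmetry : GraphProblem (Fin 3 → Fin 3) := fun n G =>
  {S | (∀ v, deg G v = 3) → (∃ y, ∀ v, S v = y) →
    ∃ m : Fin n → Fin n, ∀ v, G.Adj v (m v) ∧ m (m v) = v}

/-- Every node outputs, for each of its first three ports, the port number at the other end. -/
def portReader (Δ : ℕ) : DSM (Fin 3 → Fin 3) Δ where
  Z := Unit
  z₀ _ := Sum.inr ()
  M := ℕ
  m₀ := 0
  μ _ i := i
  δ _ a := Sum.inl fun j => if h : (j : ℕ) < Δ then Fin.ofNat 3 (a ⟨j, h⟩) else 0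

theorem exists_fixed_of_involutive :
    ∀ y : Fin 3 → Fin 3, (∀ j, y (y j) = j) → ∃ j, y j = j := by
  decide

theorem PortNumbering.Consistent.source_source {n : ℕ} {G : SimpleGraph (Fin n)}
    {pn : PortNumbering G} (h : pn.Consistent) (q : Port G) :
    pn.source (pn.source q.1 q.2).1 (pn.source q.1 q.2).2 = q :=
  pn.source_eq_of_p_eq (by rw [← h (pn.source q.1 q.2), p_source])

theorem vvc_breakCubicSymmetry : VVc breakCubicSymmetry := by
  refine ⟨portReader, fun _ _ => 1, fun Δ n G hG pn hc => ⟨_, ?_, fun v => rfl⟩⟩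
  rintro h3 ⟨y, hy⟩
  rcases isEmpty_or_nonempty (Fin n) with _ | ⟨⟨v₀⟩⟩
  · exact ⟨id, isEmptyElim⟩
  have hport : ∀ (v : Fin n) (j : Fin 3),
      ((pn.source v (j.cast (h3 v).symm)).2 : ℕ) = y j := by
    intro v j
    have hj : (j : ℕ) < deg G v := (h3 v).symm ▸ j.2
    have hΔ : (j : ℕ) < Δ := hj.trans_le (hG v)
    have := congrFun (hy v) j
    rw [← this]
    simp only [hΔ, dif_pos]
    change _ = ((Fin.ofNat 3 (gather pn Δ 0 (fun q => (q.2 : ℕ)) v ⟨j, hΔ⟩) : Fin 3) : ℕ)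
    rw [gather_of_lt pn (k := ⟨j, hΔ⟩) hj, Fin.val_ofNat, Nat.mod_eq_of_lt]
    · rfl
    · exact (Fin.is_lt _).trans_eq (h3 _)
  have hback : ∀ (v : Fin n) (j : Fin 3),
      pn.source (pn.source v (j.cast (h3 v).symm)).1 ((y j).cast (h3 _).symm) =
        ⟨v, j.cast (h3 v).symm⟩ := by
    intro v j
    rw [← hc.source_source ⟨v, j.cast (h3 v).symm⟩]
    congr 1
    exact Fin.ext (hport v j).symm
  obtain ⟨j, hj⟩ := exists_fixed_of_involutive y fun j => by
    have := hport (pn.source v₀ (j.cast (h3 v₀).symm)).1 (y j)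
    rw [hback] at this
    exact Fin.ext this.symm
  refine ⟨fun v => (pn.source v (j.cast (h3 v).symm)).1, fun v => ⟨pn.adj_source _ _, ?_⟩⟩
  have := hback v j
  rw [hj] at this
  exact congrArg Sigma.fst this

/-- A regular graph whose arcs are partitioned into permutations has a port numbering that
preserves port numbers. -/
noncomputable def PortNumbering.ofPerms {n d : ℕ} {G : SimpleGraph (Fin n)} (hd : ∀ v, deg G v = d)
    (f : Fin d → Equiv.Perm (Fin n)) (hf : ∀ u v, (∃ i, f i u = v) ↔ G.Adj u v) :
    PortNumbering G where
  p :=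
    let e : Port G ≃ Fin n × Fin d :=
      (Equiv.sigmaCongrRight fun v => finCongr (hd v)).trans (Equiv.sigmaEquivProd _ _)
    (e.trans ⟨fun x => (f x.2 x.1, x.2), fun x => ((f x.2).symm x.1, x.2),
      fun x => by simp, fun x => by simp⟩).trans e.symm
  adj u v := by
    rw [← hf]
    exact ⟨fun ⟨i, hi⟩ => ⟨i.cast (hd u), hi⟩, fun ⟨i, hi⟩ => ⟨i.cast (hd u).symm, hi⟩⟩

theorem exec_ofPerms_eq {Y : Type} {Δ n d : ℕ} {G : SimpleGraph (Fin n)} (A : DSM Y Δ)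
    (hG : ∀ v, deg G v ≤ Δ) (hd : ∀ v, deg G v = d) (f : Fin d → Equiv.Perm (Fin n))
    (hf : ∀ u v, (∃ i, f i u = v) ↔ G.Adj u v) (t : ℕ) (u v : Fin n) :
    exec A G hG (.ofPerms hd f hf) t u = exec A G hG (.ofPerms hd f hf) t v := by
  induction t generalizing u v with
  | zero => simp only [exec, hd]
  | succ t ih =>
    rw [exec_succ, exec_succ, ih u v]
    congr 1
    funext k
    by_cases hk : (k : ℕ) < d
    · rw [gather_of_lt _ (hk.trans_eq (hd u).symm), gather_of_lt _ (hk.trans_eq (hd v).symm),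
        sent, sent, ih]
      rfl
    · rw [gather_of_le _ ((hd u).trans_le (not_lt.1 hk)),
        gather_of_le _ ((hd v).trans_le (not_lt.1 hk))]

/-- The smallest cubic graph without a perfect matching: three copies of a graph with five nodes
attached to a centre. -/
def sylvester : SimpleGraph (Fin 16) :=
  SimpleGraph.fromRel fun u v =>
    (u, v) ∈ [(0, 1), (1, 2), (1, 3), (2, 4), (2, 5), (3, 4), (3, 5), (4, 5),
      (0, 6), (6, 7), (6, 8), (7, 9), (7, 10), (8, 9), (8, 10), (9, 10),
      (0, 11), (11, 12), (11, 13), (12, 14), (12, 15), (13, 14), (13, 15), (14, 15)]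

instance : DecidableRel sylvester.Adj := fun u v =>
  inferInstanceAs (Decidable (u ≠ v ∧ (_ ∨ _)))

theorem deg_sylvester (v : Fin 16) : deg sylvester v = 3 := by
  rw [deg, Nat.card_eq_fintype_card]
  revert v
  decide +kernel

/-- A decomposition of the arcs of the graph into three permutations. -/
def sylvesterPerm : Fin 3 → Equiv.Perm (Fin 16) := ![
  ⟨![11, 2, 1, 4, 5, 3, 7, 6, 9, 10, 8, 0, 15, 14, 13, 12],
    ![11, 2, 1, 5, 3, 4, 7, 6, 10, 8, 9, 0, 15, 14, 13, 12], by decide, by decide⟩,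
  ⟨![6, 3, 5, 1, 2, 4, 0, 9, 10, 8, 7, 12, 14, 11, 15, 13],
    ![6, 3, 4, 1, 5, 2, 0, 10, 9, 7, 8, 13, 11, 15, 12, 14], by decide, by decide⟩,
  ⟨![1, 0, 4, 5, 3, 2, 8, 10, 6, 7, 9, 13, 11, 15, 12, 14],
    ![1, 0, 5, 4, 2, 3, 8, 9, 6, 10, 7, 12, 14, 11, 15, 13], by decide, by decide⟩]

theorem sylvesterPerm_iff_adj (u v : Fin 16) :
    (∃ i, sylvesterPerm i u = v) ↔ sylvester.Adj u v := by
  revert u v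
  decide +kernel

/-- In a perfect matching, the node through which a five-node gadget is attached is matched with
the node outside of the gadget. -/
theorem eq_outside_of_matching {V : Type*} {m : V → V} (hm : ∀ v, m (m v) = v) {o a b c d e : V}
    (hne : [a, b, c, d, e].Nodup) (ha : m a = o ∨ m a = b ∨ m a = c)
    (hb : m b = a ∨ m b = d ∨ m b = e) (hc : m c = a ∨ m c = d ∨ m c = e)
    (hd : m d = b ∨ m d = c ∨ m d = e) (he : m e = b ∨ m e = c ∨ m e = d) : m a = o := by
  simp only [List.nodup_cons, List.mem_cons, List.not_mem_nil, not_or] at hne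
  grind

theorem no_matching_sylvester :
    ¬ ∃ m : Fin 16 → Fin 16, ∀ v, sylvester.Adj v (m v) ∧ m (m v) = v := by
  rintro ⟨m, h⟩
  have hm := fun v => (h v).2
  have h₁ : m 1 = 0 := eq_outside_of_matching hm (b := 2) (c := 3) (d := 4) (e := 5) (by decide)
    (by have := (h 1).1; revert this; generalize m 1 = x; revert x; decide)
    (by have := (h 2).1; revert this; generalize m 2 = x; revert x; decide)
    (by have := (h 3).1; revert this; generalize m 3 = x; revert x; decide)
    (by have := (h 4).1; revert this; generalize m 4 = x; revert x; decide)
    (by have := (h 5).1; revert this; generalize m 5 = x; revert x; decide)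
  have h₂ : m 6 = 0 := eq_outside_of_matching hm (b := 7) (c := 8) (d := 9) (e := 10) (by decide)
    (by have := (h 6).1; revert this; generalize m 6 = x; revert x; decide)
    (by have := (h 7).1; revert this; generalize m 7 = x; revert x; decide)
    (by have := (h 8).1; revert this; generalize m 8 = x; revert x; decide)
    (by have := (h 9).1; revert this; generalize m 9 = x; revert x; decide)
    (by have := (h 10).1; revert this; generalize m 10 = x; revert x; decide)
  have := hm 1
  rw [h₁, ← h₂, hm] at this
  exact absurd this (by decide)

theorem not_vv_breakCubicSymmetry : ¬ VV breakCubicSymmetry := by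
  rintro ⟨A, T, h⟩
  obtain ⟨S, hS, hu⟩ := h 3 16 sylvester (fun v => (deg_sylvester v).le)
    (.ofPerms deg_sylvester sylvesterPerm sylvesterPerm_iff_adj)
  refine no_matching_sylvester (hS deg_sylvester ⟨S 0, fun v => Sum.inl_injective (β := (A 3).Z) ?_⟩)
  rw [← hu, ← hu]
  exact exec_ofPerms_eq ..

end CubicSymmetry

section Histories

theorem exists_perm_of_ofFn_eq {α : Type*} {d : ℕ} {f g : Fin d → α}
    (h : (List.ofFn f : Multiset α) = List.ofFn g) :
    ∃ σ : Equiv.Perm (Fin d), ∀ k, f k = g (σ k) := by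
  classical
  have hcard (c : α) : Fintype.card {k // f k = c} = Fintype.card {k // g k = c} := by
    simp only [← Fin.univ_val_map] at h
    have := congrArg (Multiset.count c) h
    rw [Multiset.count_map, Multiset.count_map] at this
    simpa only [Fintype.card_subtype, Finset.card, Finset.filter_val, eq_comm] using this
  let e (c : α) : {k // f k = c} ≃ {k // g k = c} := Fintype.equivOfCardEq (hcard c)
  exact ⟨Equiv.ofFiberEquiv e, fun k => (Equiv.ofFiberEquiv_map e k).symm⟩

/-- Two vectors that agree on the padding have the same entries, with multiplicities, if and only
if they differ by a permutation of the initial segment. -/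
theorem ofFn_eq_iff_exists_perm {α : Type*} {d Δ : ℕ} (hd : d ≤ Δ) {f g : Fin Δ → α}
    (h : ∀ k : Fin Δ, d ≤ k → f k = g k) :
    (List.ofFn f : Multiset α) = List.ofFn g ↔
      ∃ σ : Equiv.Perm (Fin d), ∀ k, f (k.castLE hd) = g ((σ k).castLE hd) := by
  obtain ⟨e, rfl⟩ := Nat.exists_eq_add_of_le hd
  have hpad : (List.ofFn fun i => f (Fin.natAdd d i)) = List.ofFn fun i => g (Fin.natAdd d i) :=
    congrArg List.ofFn (funext fun i => h _ (Nat.le_add_right _ _))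
  rw [List.ofFn_add, List.ofFn_add, hpad, ← Multiset.coe_add, ← Multiset.coe_add, add_left_inj]
  refine ⟨exists_perm_of_ofFn_eq, fun ⟨σ, hσ⟩ => Multiset.coe_eq_coe.2 ?_⟩
  have : (fun i => f (Fin.castLE hd i)) = (fun i => g (Fin.castLE hd i)) ∘ σ := funext hσ
  exact this ▸ σ.ofFn_comp_perm _

variable {α : Type*}

/-- A history as it is seen by a neighbour: nothing is visible once the sender has stopped. -/
def visible : List (Option α) → List (Option α)
  | some m :: l => some m :: l
  | _ => []

theorem filter_ne_nil_map_visible [DecidableEq (List (Option α))] (S : Multiset (List (Option α))) :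
    (S.map visible).filter (· ≠ []) = S.filter (visible · ≠ []) := by
  rw [Multiset.filter_map]
  refine (Multiset.map_congr rfl fun l hl => ?_).trans (Multiset.map_id' _)
  rcases l with _ | ⟨_ | m, l⟩
  · exact absurd rfl (Multiset.mem_filter.1 hl).2
  · exact absurd rfl (Multiset.mem_filter.1 hl).2
  · rfl

theorem map_cons_none_map_tail_filter [DecidableEq (List (Option α))]
    {S : Multiset (List (Option α))} (hS : [] ∉ S) :
    ((S.filter (¬ visible · ≠ [])).map List.tail).map (none :: ·) =
      S.filter (¬ visible · ≠ []) := by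
  rw [Multiset.map_map]
  refine (Multiset.map_congr rfl fun l hl => ?_).trans (Multiset.map_id' _)
  rcases l with _ | ⟨_ | m, l⟩
  · exact absurd (Multiset.mem_filter.1 hl).1 hS
  · rfl
  · simp [visible] at hl

/-- A multiset of histories is determined by the previous histories and by the visible
histories. -/
theorem eq_of_map_tail_of_map_visible {S R : Multiset (List (Option α))} (hS : [] ∉ S)
    (hR : [] ∉ R) (ht : S.map List.tail = R.map List.tail) (hv : S.map visible = R.map visible) :
    S = R := by
  classical
  have h1 : S.filter (visible · ≠ []) = R.filter (visible · ≠ []) := by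
    rw [← filter_ne_nil_map_visible, hv, filter_ne_nil_map_visible]
  rw [← Multiset.filter_add_not (visible · ≠ []) S, ← Multiset.filter_add_not (visible · ≠ []) R,
    Multiset.map_add, Multiset.map_add, h1, add_right_inj] at ht
  rw [← Multiset.filter_add_not (visible · ≠ []) S, ← Multiset.filter_add_not (visible · ≠ []) R,
    h1, ← map_cons_none_map_tail_filter hS, ht, map_cons_none_map_tail_filter hR]

end Histories

section Unordered

variable {Y : Type} {Δ : ℕ}

namespace DSM

/-- The state of a node in the simulation of a broadcasting machine: its degree, its simulated
state, its history, and the histories attributed to its neighbours. -/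
structure Transcript (A : DSM Y Δ) where
  degree : ℕ
  state : Y ⊕ A.Z
  own : List (Option A.M)
  others : Fin Δ → List (Option A.M)

/-- The message broadcast in a given state; a stopped node is silent. -/
noncomputable def report (A : DSM Y Δ) : Y ⊕ A.Z → Option A.M
  | Sum.inl _ => none
  | Sum.inr z => some (if h : 0 < Δ then A.μ z ⟨0, h⟩ else A.m₀)

/-- The last message of a history. -/
def latest (A : DSM Y Δ) : List (Option A.M) → A.M
  | some m :: _ => m
  | _ => A.m₀

theorem InBroadcast.latest_report {A : DSM Y Δ} (hA : A.InBroadcast) (x : Y ⊕ A.Z)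
    (l : List (Option A.M)) (i : Fin Δ) : A.latest (A.report x :: l) = A.μ' x i := by
  cases x with
  | inl y => rfl
  | inr z =>
    have h : 0 < Δ := i.pos
    simp only [report, latest, μ', dif_pos h]
    exact hA z _ _

namespace Transcript

variable {A : DSM Y Δ}

/-- The history of a node, including the current round. -/
noncomputable def current (s : A.Transcript) : List (Option A.M) :=
  A.report s.state :: s.own

/-- The histories `h` extend those known in `s`, and explain the visible histories `a`. -/
def Extends (s : A.Transcript) (a h : Fin Δ → List (Option A.M)) : Prop :=
  (∀ k, ∃ m, h k = m :: s.others k) ∧ (∀ k : Fin Δ, s.degree ≤ k → h k = none :: s.others k) ∧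
    (List.ofFn fun k => visible (h k) : Multiset (List (Option A.M))) = List.ofFn a

/-- Attribute the received histories to the neighbours. -/
noncomputable def extend (s : A.Transcript) (a : Fin Δ → List (Option A.M)) :
    Fin Δ → List (Option A.M) :=
  Classical.epsilon (s.Extends a)

theorem extend_congr (s : A.Transcript) {a b : Fin Δ → List (Option A.M)}
    (h : (List.ofFn a : Multiset (List (Option A.M))) = List.ofFn b) : s.extend a = s.extend b := by
  have : s.Extends a = s.Extends b := by
    funext h'
    simp only [Extends, h]
  rw [extend, extend, this]

/-- One round of the simulation. -/
noncomputable def step (s : A.Transcript) (a : Fin Δ → List (Option A.M)) : A.Transcript where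
  degree := s.degree
  state := A.δ' s.state fun k => A.latest (s.extend a k)
  own := s.current
  others := s.extend a

/-- The transcript as a state of the simulation. -/
def toState (s : A.Transcript) : Y ⊕ A.Transcript :=
  match s.state with
  | Sum.inl y => Sum.inl y
  | Sum.inr _ => Sum.inr s

/-- The transcript before the first round. -/
def start (A : DSM Y Δ) (d : Fin (Δ + 1)) : A.Transcript := ⟨d, A.z₀ d, [], fun _ => []⟩

end Transcript

/-- The simulation of a broadcasting machine, in which the nodes broadcast their histories and
ignore the order of the incoming messages. -/
noncomputable def unordered (A : DSM Y Δ) : DSM Y Δ where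
  Z := A.Transcript
  z₀ d := (Transcript.start A d).toState
  M := List (Option A.M)
  m₀ := []
  μ s _ := visible s.current
  δ s a := (s.step a).toState

theorem inMultiset_unordered (A : DSM Y Δ) : A.unordered.InMultiset := fun s a b h => by
  change (s.step a).toState = (s.step b).toState
  simp only [Transcript.step, s.extend_congr h]

theorem inBroadcast_unordered (A : DSM Y Δ) : A.unordered.InBroadcast := fun _ _ _ => rfl

theorem μ'_toState {A : DSM Y Δ} (s : A.Transcript) (i : Fin Δ) :
    A.unordered.μ' s.toState i = visible s.current := by
  rcases s with ⟨d, y | z, own, others⟩ <;> rfl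

theorem δ'_toState {A : DSM Y Δ} (s : A.Transcript) (a : Fin Δ → List (Option A.M)) :
    A.unordered.δ' s.toState a = (s.step a).toState := by
  rcases s with ⟨d, y | z, own, others⟩ <;> rfl

end DSM

variable {n : ℕ} {G : SimpleGraph (Fin n)} (A : DSM Y Δ) (hG : ∀ v, deg G v ≤ Δ)
  (pn : PortNumbering G)

/-- The transcripts in the simulation, continued after the nodes have stopped. -/
noncomputable def transcript : ℕ → Fin n → A.Transcript
  | 0, u => DSM.Transcript.start A ⟨deg G u, Nat.lt_succ_of_le (hG u)⟩
  | t + 1, u => (transcript t u).step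
      (gather pn Δ [] (fun q => visible (transcript t q.1).current) u)

theorem exec_unordered (t : ℕ) (u : Fin n) :
    exec A.unordered G hG pn t u = (transcript A hG pn t u).toState := by
  induction t generalizing u with
  | zero => rfl
  | succ t ih =>
    rw [exec_succ, ih]
    refine (DSM.δ'_toState _ _).trans (congrArg (fun f => DSM.Transcript.toState
      ((transcript A hG pn t u).step (gather pn Δ [] f u))) (funext fun q => ?_))
    rw [sent, ih]
    exact DSM.μ'_toState _ _

theorem transcript_degree (t : ℕ) (u : Fin n) : (transcript A hG pn t u).degree = deg G u := by
  induction t with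
  | zero => rfl
  | succ t ih => exact ih

theorem transcript_succ_own (t : ℕ) (u : Fin n) :
    (transcript A hG pn (t + 1) u).own = (transcript A hG pn t u).current :=
  rfl

/-- The actual histories of the neighbours of `u`. -/
noncomputable def past (t : ℕ) (u : Fin n) : Fin Δ → List (Option A.M) :=
  gather pn Δ (List.replicate t none) (fun q => (transcript A hG pn t q.1).own) u

theorem past_castLE (t : ℕ) {u : Fin n} (k : Fin (deg G u)) :
    past A hG pn t u (k.castLE (hG u)) = (transcript A hG pn t (pn.source u k).1).own :=
  gather_castLE pn (hG u) k

theorem past_of_le (t : ℕ) {u : Fin n} {k : Fin Δ} (h : deg G u ≤ k) :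
    past A hG pn t u k = List.replicate t none :=
  gather_of_le pn h

theorem exists_past_succ (t : ℕ) (u : Fin n) (k : Fin Δ) :
    ∃ m, past A hG pn (t + 1) u k = m :: past A hG pn t u k := by
  by_cases h : (k : ℕ) < deg G u
  · rw [past, past, gather_of_lt pn h, gather_of_lt pn h]
    exact ⟨_, rfl⟩
  · rw [past_of_le A hG pn _ (not_lt.1 h), past_of_le A hG pn _ (not_lt.1 h)]
    exact ⟨none, rfl⟩

theorem visible_past (t : ℕ) (u : Fin n) :
    (fun k => visible (past A hG pn (t + 1) u k)) =
      gather pn Δ [] (fun q => visible (transcript A hG pn t q.1).current) u := by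
  funext k
  by_cases h : (k : ℕ) < deg G u
  · rw [past, gather_of_lt pn h, gather_of_lt pn h, transcript_succ_own]
  · rw [past_of_le A hG pn _ (not_lt.1 h), gather_of_le pn (not_lt.1 h)]
    rfl

theorem exists_extends {t : ℕ} {u : Fin n}
    (hpad : ∀ k : Fin Δ, deg G u ≤ k → (transcript A hG pn t u).others k = List.replicate t none)
    (h : (List.ofFn (transcript A hG pn t u).others : Multiset (List (Option A.M))) =
      List.ofFn (past A hG pn t u)) :
    ∃ h', (transcript A hG pn t u).Extends
      (gather pn Δ [] (fun q => visible (transcript A hG pn t q.1).current) u) h' := by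
  obtain ⟨σ, hσ⟩ := (ofFn_eq_iff_exists_perm (hG u) fun k hk => by
    rw [hpad k hk, past_of_le A hG pn t hk]).1 h
  have hσ' (k : Fin Δ) (hk : (k : ℕ) < deg G u) : (transcript A hG pn t u).others k =
    past A hG pn t u ((σ ⟨k, hk⟩).castLE (hG u)) := hσ ⟨k, hk⟩
  refine ⟨fun k => if hk : (k : ℕ) < deg G u then
    past A hG pn (t + 1) u ((σ ⟨k, hk⟩).castLE (hG u)) else none :: (transcript A hG pn t u).others k,
    fun k => ?_, fun k hk => ?_, ?_⟩
  · by_cases hk : (k : ℕ) < deg G u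
    · simp only [dif_pos hk, hσ' k hk]
      exact exists_past_succ A hG pn t u _
    · simp only [dif_neg hk]
      exact ⟨none, rfl⟩
  · rw [transcript_degree] at hk
    exact dif_neg hk.not_gt
  · rw [← visible_past, ofFn_eq_iff_exists_perm (hG u)]
    · refine ⟨σ, fun k => ?_⟩
      beta_reduce
      rw [dif_pos (show ((k.castLE (hG u) : Fin Δ) : ℕ) < deg G u from k.2)]
      rfl
    · intro k hk
      beta_reduce
      rw [dif_neg hk.not_gt, past_of_le A hG pn _ hk]
      rfl

theorem transcript_others (t : ℕ) (u : Fin n) :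
    (∀ k : Fin Δ, deg G u ≤ k → (transcript A hG pn t u).others k = List.replicate t none) ∧
    (List.ofFn (transcript A hG pn t u).others : Multiset (List (Option A.M))) =
      List.ofFn (past A hG pn t u) := by
  induction t with
  | zero =>
    refine ⟨fun _ _ => rfl, ?_⟩
    congr 2
    funext k
    by_cases h : (k : ℕ) < deg G u
    · rw [past, gather_of_lt pn h]; rfl
    · rw [past_of_le A hG pn _ (not_lt.1 h)]; rfl
  | succ t ih =>
    obtain ⟨h1, h2, h3⟩ : (transcript A hG pn t u).Extends _ (transcript A hG pn (t + 1) u).others :=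
      Classical.epsilon_spec (exists_extends A hG pn ih.1 ih.2)
    rw [transcript_degree] at h2
    refine ⟨fun k hk => by rw [h2 k hk, ih.1 k hk]; rfl,
      eq_of_map_tail_of_map_visible ?_ ?_ ?_ ?_⟩
    · simp only [Multiset.mem_coe, List.mem_ofFn, not_exists]
      intro k hk
      obtain ⟨m, hm⟩ := h1 k
      simp [hm] at hk
    · simp only [Multiset.mem_coe, List.mem_ofFn, not_exists]
      intro k hk
      obtain ⟨m, hm⟩ := exists_past_succ A hG pn t u k
      simp [hm] at hk
    · have e1 : List.tail ∘ (transcript A hG pn (t + 1) u).others =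
          (transcript A hG pn t u).others := by
        funext k
        obtain ⟨m, hm⟩ := h1 k
        simp [hm]
      have e2 : List.tail ∘ past A hG pn (t + 1) u = past A hG pn t u := by
        funext k
        obtain ⟨m, hm⟩ := exists_past_succ A hG pn t u k
        simp [hm]
      rw [Multiset.map_coe, Multiset.map_coe, List.map_ofFn, List.map_ofFn, e1, e2, ih.2]
    · rw [Multiset.map_coe, Multiset.map_coe, List.map_ofFn, List.map_ofFn]
      exact h3.trans (by rw [← visible_past]; rfl)

theorem transcript_succ_others_tail (t : ℕ) (u : Fin n) (k : Fin Δ) :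
    ((transcript A hG pn (t + 1) u).others k).tail = (transcript A hG pn t u).others k := by
  have ih := transcript_others A hG pn t u
  obtain ⟨h1, -⟩ : (transcript A hG pn t u).Extends _ (transcript A hG pn (t + 1) u).others :=
    Classical.epsilon_spec (exists_extends A hG pn ih.1 ih.2)
  obtain ⟨m, hm⟩ := h1 k
  rw [hm, List.tail_cons]

theorem exists_perm_transcript_others (T : ℕ) :
    ∃ σ : ∀ u, Equiv.Perm (Fin (deg G u)), ∀ t ≤ T, ∀ u k,
      (transcript A hG pn t u).others (k.castLE (hG u)) =
        (transcript A hG pn t (pn.source u (σ u k)).1).own := by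
  have h (u : Fin n) := (ofFn_eq_iff_exists_perm (hG u) fun k hk => by
    rw [(transcript_others A hG pn T u).1 k hk, past_of_le A hG pn T hk]).1
      (transcript_others A hG pn T u).2
  choose σ hσ using h
  refine ⟨σ, fun t ht => ?_⟩
  induction ht using Nat.decreasingInduction with
  | self => exact fun u k => (hσ u k).trans (past_castLE A hG pn T _)
  | of_succ k _ ih =>
    intro u i
    rw [← transcript_succ_others_tail, ih]
    rfl

theorem exists_exec_eq_transcript {A : DSM Y Δ} (hA : A.InBroadcast) (T : ℕ) :
    ∃ pn' : PortNumbering G, ∀ u, (transcript A hG pn T u).state = exec A G hG pn' T u := by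
  obtain ⟨σ, hσ⟩ := exists_perm_transcript_others A hG pn T
  suffices ∀ t ≤ T, ∀ u, (transcript A hG pn t u).state = exec A G hG (pn.permute σ) t u from
    ⟨pn.permute σ, this T le_rfl⟩
  intro t ht
  induction t with
  | zero => exact fun _ => rfl
  | succ t ih =>
    intro u
    have ih := ih (Nat.le_of_succ_le ht)
    rw [exec_succ, ← ih u]
    change A.δ' _ (fun k => A.latest ((transcript A hG pn (t + 1) u).others k)) = _
    congr 1
    funext k
    by_cases hk : (k : ℕ) < deg G u
    · rw [gather_of_lt _ hk, sent, ← ih, PortNumbering.source_permute]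
      refine (congrArg A.latest (hσ _ ht u ⟨k, hk⟩)).trans ?_
      exact hA.latest_report _ _ _
    · rw [gather_of_le _ (not_lt.1 hk), (transcript_others A hG pn (t + 1) u).1 k (not_lt.1 hk)]
      rfl

theorem VB.mb {P : GraphProblem Y} (h : VB P) : MB P := by
  obtain ⟨A, hA, T, h⟩ := h
  refine ⟨fun Δ => (A Δ).unordered,
    fun Δ => ⟨(A Δ).inMultiset_unordered, (A Δ).inBroadcast_unordered⟩, T, fun Δ n G hG pn => ?_⟩
  obtain ⟨pn', hpn'⟩ := exists_exec_eq_transcript hG pn (hA Δ) (T Δ n)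
  obtain ⟨S, hS, hu⟩ := h Δ n G hG pn'
  refine ⟨S, hS, fun u => ?_⟩
  rw [exec_unordered, DSM.Transcript.toState, hpn', hu]
  rfl

end Unordered

section Labels

variable {n : ℕ} {G : SimpleGraph (Fin n)} (pn : PortNumbering G) (Δ : ℕ)

/-- The label of a node after `t` rounds in which each node refines its label by the set of the
received pairs of the label and the port number of the sender. -/
noncomputable def label : ℕ → Fin n → ℕ
  | 0, _ => 0
  | t + 1, u => Encodable.encode (label t u,
      Finset.univ.image (gather pn Δ none (fun q => some (label t q.1, (q.2 : ℕ))) u))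

/-- The identifier attached to the message of a port. -/
noncomputable def portId (t : ℕ) (q : Port G) : ℕ × ℕ := (label pn Δ t q.1, q.2)

variable {Δ}

theorem label_eq_of_succ {t : ℕ} {u v : Fin n} (h : label pn Δ (t + 1) u = label pn Δ (t + 1) v) :
    label pn Δ t u = label pn Δ t v :=
  congrArg Prod.fst (Encodable.encode_injective h)

theorem label_eq_of_le {s t : ℕ} (hst : s ≤ t) {u v : Fin n} (h : label pn Δ t u = label pn Δ t v) :
    label pn Δ s u = label pn Δ s v := by
  induction hst using Nat.decreasingInduction with
  | self => exact h
  | of_succ _ _ ih => exact label_eq_of_succ pn ih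

theorem exists_portId_eq_of_label_eq (hG : ∀ v, deg G v ≤ Δ) {t : ℕ} {u v : Fin n}
    (h : label pn Δ (t + 1) u = label pn Δ (t + 1) v) (k : Fin (deg G u)) :
    ∃ l, portId pn Δ t (pn.source v l) = portId pn Δ t (pn.source u k) := by
  have := Finset.ext_iff.1 (congrArg Prod.snd (Encodable.encode_injective h))
    (some (portId pn Δ t (pn.source u k)))
  simp only [Finset.mem_image, Finset.mem_univ, true_and,
    exists_gather_eq pn (hG _) (Option.some_ne_none _)] at this
  obtain ⟨l, hl⟩ := this.1 ⟨k, rfl⟩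
  exact ⟨l, Option.some_injective _ hl⟩

variable (Δ) in
/-- The ports of `u` leading to nodes with the same label as `w`. -/
noncomputable def portsLike (t : ℕ) (u w : Fin n) : Finset (Fin (deg G u)) :=
  Finset.univ.filter fun k => label pn Δ t (pn.source u k).1 = label pn Δ t w

theorem card_portsLike_succ_le (hG : ∀ v, deg G v ≤ Δ) (t : ℕ) (u w : Fin n) :
    (portsLike pn Δ (t + 1) u w).card ≤
      ((portsLike pn Δ t w u).image fun k => ((pn.source w k).2 : ℕ)).card := by
  choose i hi using fun k => pn.exists_target_eq (pn.adj_source u k)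
  refine Finset.card_le_card_of_injOn (fun k => (i k : ℕ)) (fun k hk => ?_) fun k _ l _ h => ?_
  · obtain ⟨j, hj⟩ := pn.exists_source_eq (hi k)
    obtain ⟨l, hl⟩ := exists_portId_eq_of_label_eq pn hG (Finset.mem_filter.1 hk).2 j
    rw [hj] at hl
    exact Finset.mem_image.2 ⟨l, Finset.mem_filter.2 ⟨Finset.mem_univ _, congrArg Prod.fst hl⟩,
      congrArg Prod.snd hl⟩
  · apply pn.source_injective
    rw [← hi, ← hi, Fin.ext h]

theorem portId_source_injective (hG : ∀ v, deg G v ≤ Δ) {u : Fin n} {k l : Fin (deg G u)}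
    (h : portId pn Δ (2 * Δ + 2) (pn.source u k) = portId pn Δ (2 * Δ + 2) (pn.source u l)) :
    k = l := by
  by_contra hne
  set w := (pn.source u k).1 with hw
  have hlt (t : ℕ) (ht : t ≤ 2 * Δ + 2) :
      ((portsLike pn Δ t u w).image fun k => ((pn.source u k).2 : ℕ)).card <
        (portsLike pn Δ t u w).card := by
    refine lt_of_le_of_ne Finset.card_image_le fun hcard => hne ?_
    refine Finset.card_image_iff.1 hcard ?_ ?_ (congrArg Prod.snd h)
    · exact Finset.mem_filter.2 ⟨Finset.mem_univ _, rfl⟩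
    · exact Finset.mem_filter.2
        ⟨Finset.mem_univ _, (label_eq_of_le pn ht (congrArg Prod.fst h)).symm⟩
  have hdesc (j : ℕ) (hj : j ≤ Δ + 1) :
      (portsLike pn Δ (2 * j) u w).card + j ≤ (portsLike pn Δ 0 u w).card := by
    induction j with
    | zero => rfl
    | succ j ih =>
      have h1 := card_portsLike_succ_le pn hG (2 * j + 1) u w
      have h2 := card_portsLike_succ_le pn hG (2 * j) w u
      have h3 := hlt (2 * j) (by omega)
      have h4 := ih (by omega)
      have h5 : ((portsLike pn Δ (2 * j + 1) w u).image fun k => ((pn.source w k).2 : ℕ)).card ≤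
        (portsLike pn Δ (2 * j + 1) w u).card := Finset.card_image_le
      rw [show 2 * (j + 1) = 2 * j + 1 + 1 by ring]
      omega
  have h1 := hdesc (Δ + 1) le_rfl
  have h2 : (portsLike pn Δ 0 u w).card ≤ deg G u := (Finset.card_le_univ _).trans (by simp)
  have := hG u
  omega

end Labels

section SetSimulation

variable {Y : Type} {Δ : ℕ}

/-- The `ids` of the first `d` ports are distinct elements of `I`. -/
def Identifies (d : ℕ) (I : Finset (Option (ℕ × ℕ))) (ids : Fin Δ → ℕ × ℕ) : Prop :=
  (∀ k : Fin Δ, (k : ℕ) < d → some (ids k) ∈ I) ∧ Set.InjOn ids {k | (k : ℕ) < d}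

open Classical in
/-- The content of the message in `R` with a given identifier. -/
noncomputable def contentOf {M : Type} (m₀ : M) (R : Set (Option ((ℕ × ℕ) × M))) (i : ℕ × ℕ) : M :=
  if h : ∃ m, some (i, m) ∈ R then h.choose else m₀

theorem contentOf_gather {n : ℕ} {G : SimpleGraph (Fin n)} {pn : PortNumbering G} {u : Fin n}
    (hu : deg G u ≤ Δ) {M : Type} {m₀ : M} {f : Port G → ℕ × ℕ} {g : Port G → M}
    {F : Port G → Option ((ℕ × ℕ) × M)}
    (hf : ∀ k l, f (pn.source u k) = f (pn.source u l) → k = l)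
    (hF : ∀ q, F q = some (f q, g q) ∨ F q = none ∧ g q = m₀) (k : Fin (deg G u)) :
    contentOf m₀ (Set.range (gather pn Δ none F u)) (f (pn.source u k)) = g (pn.source u k) := by
  have key {m : M} (h : some (f (pn.source u k), m) ∈ Set.range (gather pn Δ none F u)) :
      F (pn.source u k) = some (f (pn.source u k), m) := by
    obtain ⟨l, hl⟩ := (exists_gather_eq pn hu (Option.some_ne_none _)).1 h
    rcases hF (pn.source u l) with h' | ⟨h', -⟩
    · rw [h', Option.some.injEq, Prod.mk.injEq] at hl
      obtain rfl := hf l k hl.1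
      rw [h', hl.2]
    · simp [h'] at hl
  rcases hF (pn.source u k) with h | ⟨h, h'⟩
  · have hex : ∃ m, some (f (pn.source u k), m) ∈ Set.range (gather pn Δ none F u) :=
      ⟨_, (exists_gather_eq pn hu (Option.some_ne_none _)).2 ⟨k, h⟩⟩
    rw [contentOf, dif_pos hex]
    have := key hex.choose_spec
    rw [h, Option.some.injEq, Prod.mk.injEq] at this
    exact this.2.symm
  · rw [contentOf, dif_neg, h']
    rintro ⟨m, hm⟩
    simp [key hm] at h

namespace DSM

/-- The state of a node in the simulation of a machine by a machine in `Set`: the number of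
rounds (up to the start of the simulation), the degree, the label, the identifiers of the ports,
and the simulated state. -/
structure Labelled (A : DSM Y Δ) where
  round : ℕ
  degree : ℕ
  label : ℕ
  ids : Fin Δ → ℕ × ℕ
  state : Y ⊕ A.Z

namespace Labelled

variable {A : DSM Y Δ}

/-- The identifiers of the received messages. -/
def receivedIds (a : Fin Δ → Option ((ℕ × ℕ) × A.M)) : Finset (Option (ℕ × ℕ)) :=
  Finset.univ.image fun k => (a k).map Prod.fst

/-- One round of the preparation. -/
def prepare (s : A.Labelled) (a : Fin Δ → Option ((ℕ × ℕ) × A.M)) : A.Labelled :=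
  { s with
    round := s.round + 1
    label := Encodable.encode (s.label, receivedIds a) }

/-- One round of the simulation with the given identifiers of the ports. -/
noncomputable def simulate (s : A.Labelled) (ids : Fin Δ → ℕ × ℕ)
    (a : Fin Δ → Option ((ℕ × ℕ) × A.M)) : A.Labelled :=
  { s with
    round := 2 * Δ + 3
    ids := ids
    state := A.δ' s.state fun k =>
      if (k : ℕ) < s.degree then contentOf A.m₀ (Set.range a) (ids k) else A.m₀ }

/-- One round of the preparation or of the simulation. -/
noncomputable def step (s : A.Labelled) (a : Fin Δ → Option ((ℕ × ℕ) × A.M)) : A.Labelled :=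
  if s.round < 2 * Δ + 2 then s.prepare a
  else if s.round = 2 * Δ + 2 then
    s.simulate (Classical.epsilon (Identifies s.degree (receivedIds a))) a
  else s.simulate s.ids a

theorem step_congr (s : A.Labelled) {a b : Fin Δ → Option ((ℕ × ℕ) × A.M)}
    (h : Set.range a = Set.range b) : s.step a = s.step b := by
  have : receivedIds a = receivedIds b := by
    apply Finset.coe_injective
    simp only [receivedIds, Finset.coe_image, Finset.coe_univ, Set.image_univ]
    exact (Set.range_comp (Option.map Prod.fst) a).trans
      (h ▸ (Set.range_comp (Option.map Prod.fst) b).symm)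
  simp only [step, prepare, simulate, h, this]

/-- The corresponding state of the simulating machine, which does not stop before the end of the
preparation. -/
def toState (s : A.Labelled) : Y ⊕ A.Labelled :=
  if s.round ≤ 2 * Δ + 2 then Sum.inr s else s.state.map id fun _ => s

end Labelled

/-- The simulation of a machine in which the nodes first compute labels that allow them to tell
apart the messages from different ports, and then ignore the order and the multiplicities of the
incoming messages. -/
noncomputable def identified (A : DSM Y Δ) : DSM Y Δ where
  Z := A.Labelled
  z₀ d := Sum.inr ⟨0, d, 0, default, A.z₀ d⟩
  M := Option ((ℕ × ℕ) × A.M)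
  m₀ := none
  μ s i := some ((s.label, i), A.μ' s.state i)
  δ s a := (s.step a).toState

theorem inSet_identified (A : DSM Y Δ) : A.identified.InSet := fun s _ _ h =>
  congrArg Labelled.toState (s.step_congr h)

theorem identified_μ'_toState {A : DSM Y Δ} (s : A.Labelled) (i : Fin Δ) :
    A.identified.μ' s.toState i = some ((s.label, (i : ℕ)), A.μ' s.state i) ∨
      A.identified.μ' s.toState i = none ∧ A.μ' s.state i = A.m₀ := by
  rw [Labelled.toState]
  split
  · exact Or.inl rfl
  · rcases s with ⟨t, d, b, ids, y | z⟩
    · exact Or.inr ⟨rfl, rfl⟩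
    · exact Or.inl rfl

theorem identified_δ'_toState {A : DSM Y Δ} (s : A.Labelled)
    (a : Fin Δ → Option ((ℕ × ℕ) × A.M)) :
    A.identified.δ' s.toState a = (s.step a).toState := by
  rw [Labelled.toState]
  split
  · rfl
  · rename_i h
    rcases s with ⟨t, d, b, ids, y | z⟩
    · have h1 : ¬ t < 2 * Δ + 2 := fun h' => h h'.le
      have h2 : ¬ t = 2 * Δ + 2 := fun h' => h h'.le
      simp [Labelled.step, h1, h2, Labelled.simulate, Labelled.toState, δ']
      rfl
    · rfl

end DSM

variable {n : ℕ} {G : SimpleGraph (Fin n)} (A : DSM Y Δ) (hG : ∀ v, deg G v ≤ Δ)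
  (pn : PortNumbering G)

theorem receivedIds_gather {t : ℕ} {x : Fin n → Y ⊕ A.Labelled}
    (hx : ∀ v, ∃ s : A.Labelled, x v = Sum.inr s ∧ s.label = label pn Δ t v) (u : Fin n) :
    DSM.Labelled.receivedIds (gather pn Δ none (sent A.identified hG x) u) =
      Finset.univ.image (gather pn Δ none (fun q => some (portId pn Δ t q)) u) := by
  refine congrArg (Finset.univ.image ·) (funext fun k => ?_)
  by_cases hk : (k : ℕ) < deg G u
  · refine (congrArg (Option.map Prod.fst) (gather_of_lt pn hk)).trans
      (Eq.trans ?_ (gather_of_lt pn hk).symm)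
    obtain ⟨s, hs, hlabel⟩ := hx (pn.source u ⟨k, hk⟩).1
    refine (congrArg (fun z => Option.map Prod.fst (A.identified.μ' z _)) hs).trans ?_
    rw [portId, ← hlabel]
    rfl
  · exact (congrArg (Option.map Prod.fst) (gather_of_le pn (not_lt.1 hk))).trans
      (gather_of_le pn (not_lt.1 hk)).symm

theorem exec_identified_of_le {t : ℕ} (ht : t ≤ 2 * Δ + 2) (u : Fin n) :
    exec A.identified G hG pn t u = Sum.inr
      ⟨t, deg G u, label pn Δ t u, default, A.z₀ ⟨deg G u, Nat.lt_succ_of_le (hG u)⟩⟩ := by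
  induction t generalizing u with
  | zero => rfl
  | succ t ih =>
    have ih := ih (Nat.le_of_succ_le ht)
    rw [exec_succ, ih]
    have hids := receivedIds_gather A hG pn
      (fun v => ⟨_, ih v, rfl⟩) u
    refine (congrArg DSM.Labelled.toState (if_pos ht)).trans ((if_pos ht).trans
      (congrArg Sum.inr ?_))
    exact congrArg (fun I => (⟨t + 1, deg G u, Encodable.encode (label pn Δ t u, I), default,
      A.z₀ ⟨deg G u, Nat.lt_succ_of_le (hG u)⟩⟩ : A.Labelled)) hids

theorem exists_perm_of_identifies {u : Fin n} {ids : Fin Δ → ℕ × ℕ} {f : Port G → ℕ × ℕ}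
    (hu : deg G u ≤ Δ)
    (h : Identifies (deg G u) (Finset.univ.image (gather pn Δ none (fun q => some (f q)) u)) ids) :
    ∃ σ : Equiv.Perm (Fin (deg G u)), ∀ k, ids (k.castLE hu) = f (pn.source u (σ k)) := by
  have hex (k : Fin (deg G u)) : ∃ l, f (pn.source u l) = ids (k.castLE hu) := by
    obtain ⟨l, -, hl⟩ := Finset.mem_image.1 (h.1 (k.castLE hu) k.2)
    obtain ⟨l, hl⟩ := (exists_gather_eq pn hu (Option.some_ne_none _)).1 ⟨l, hl⟩
    exact ⟨l, Option.some_injective _ hl⟩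
  choose σ hσ using hex
  have hinj : Function.Injective σ := fun k l hkl => by
    have := h.2 (show ((k.castLE hu : Fin Δ) : ℕ) < deg G u from k.2)
      (show ((l.castLE hu : Fin Δ) : ℕ) < deg G u from l.2) (by rw [← hσ, ← hσ, hkl])
    exact Fin.castLE_injective hu this
  exact ⟨Equiv.ofBijective σ (Finite.injective_iff_bijective.1 hinj), fun k => (hσ k).symm⟩

theorem exists_identifies {u : Fin n} {f : Port G → ℕ × ℕ}
    (hf : ∀ k l, f (pn.source u k) = f (pn.source u l) → k = l) :
    ∃ ids : Fin Δ → ℕ × ℕ,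
      Identifies (deg G u) (Finset.univ.image (gather pn Δ none (fun q => some (f q)) u)) ids := by
  refine ⟨gather pn Δ (0, 0) f u, fun k hk => ?_, fun k hk l hl h => ?_⟩
  · exact Finset.mem_image.2 ⟨k, Finset.mem_univ _, by rw [gather_of_lt pn hk, gather_of_lt pn hk]⟩
  · rw [gather_of_lt pn hk, gather_of_lt pn hl] at h
    exact Fin.ext (Fin.mk.inj (hf _ _ h))

/-- The identifiers of the ports that the nodes fix at the end of the preparation. -/
noncomputable def chosenIds (Δ : ℕ) (u : Fin n) : Fin Δ → ℕ × ℕ :=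
  Classical.epsilon (Identifies (deg G u)
    (Finset.univ.image (gather pn Δ none (fun q => some (portId pn Δ (2 * Δ + 2) q)) u)))

theorem exists_chosenIds_eq :
    ∃ σ : ∀ u, Equiv.Perm (Fin (deg G u)), ∀ u k,
      chosenIds pn Δ u (k.castLE (hG u)) = portId pn Δ (2 * Δ + 2) (pn.source u (σ u k)) := by
  have h (u : Fin n) := exists_perm_of_identifies pn (hG u) (Classical.epsilon_spec
    (exists_identifies pn fun k l => portId_source_injective pn hG (u := u)))
  choose σ hσ using h
  exact ⟨σ, hσ⟩

theorem simulate_gather {σ : ∀ u, Equiv.Perm (Fin (deg G u))}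
    (hσ : ∀ u k, chosenIds pn Δ u (k.castLE (hG u)) =
      portId pn Δ (2 * Δ + 2) (pn.source u (σ u k)))
    {x : Fin n → A.Labelled} (hdeg : ∀ v, (x v).degree = deg G v)
    (hlabel : ∀ v, (x v).label = label pn Δ (2 * Δ + 2) v) (u : Fin n) :
    ((x u).simulate (chosenIds pn Δ u)
      (gather pn Δ none (sent A.identified hG fun v => (x v).toState) u)) =
      ⟨2 * Δ + 3, deg G u, label pn Δ (2 * Δ + 2) u, chosenIds pn Δ u, A.δ' (x u).state
        (gather (pn.permute σ) Δ A.m₀ (sent A hG fun v => (x v).state) u)⟩ := by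
  have : (fun k : Fin Δ => if (k : ℕ) < (x u).degree then contentOf A.m₀ (Set.range
      (gather pn Δ none (sent A.identified hG fun v => (x v).toState) u)) (chosenIds pn Δ u k)
      else A.m₀) = gather (pn.permute σ) Δ A.m₀ (sent A hG fun v => (x v).state) u := by
    funext k
    rw [hdeg]
    split
    · rename_i hk
      rw [gather_of_lt _ hk, PortNumbering.source_permute]
      refine (congrArg _ (hσ u ⟨k, hk⟩)).trans (contentOf_gather (hG u)
        (fun k l => portId_source_injective pn hG)
        (fun q => ?_) _)
      have := DSM.identified_μ'_toState (x q.1) (q.2.castLE (hG q.1))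
      rw [hlabel] at this
      exact this
    · rename_i hk
      exact (gather_of_le _ (not_lt.1 hk)).symm
  rw [DSM.Labelled.simulate, this, hdeg, hlabel]

theorem exec_identified_add {σ : ∀ u, Equiv.Perm (Fin (deg G u))}
    (hσ : ∀ u k, chosenIds pn Δ u (k.castLE (hG u)) =
      portId pn Δ (2 * Δ + 2) (pn.source u (σ u k))) (s : ℕ) (u : Fin n) :
    exec A.identified G hG pn (2 * Δ + 3 + s) u = DSM.Labelled.toState
      ⟨2 * Δ + 3, deg G u, label pn Δ (2 * Δ + 2) u, chosenIds pn Δ u,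
        exec A G hG (pn.permute σ) (s + 1) u⟩ := by
  induction s generalizing u with
  | zero =>
    have h := exec_identified_of_le A hG pn (le_refl (2 * Δ + 2))
    rw [add_zero, exec_succ, funext h]
    have hids := receivedIds_gather A hG pn (fun v => ⟨_, h v, rfl⟩) u
    rw [funext h] at hids
    have hstep := simulate_gather A hG pn hσ (x := fun v => ⟨2 * Δ + 2, deg G v,
      label pn Δ (2 * Δ + 2) v, default, A.z₀ ⟨deg G v, Nat.lt_succ_of_le (hG v)⟩⟩)
      (fun _ => rfl) (fun _ => rfl) u
    simp only [DSM.Labelled.toState, le_refl, if_true] at hstep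
    refine congrArg DSM.Labelled.toState (Eq.trans ?_ hstep)
    refine (if_neg (lt_irrefl _)).trans ((if_pos rfl).trans ?_)
    exact congrArg (fun I => DSM.Labelled.simulate _ (Classical.epsilon (Identifies _ I)) _) hids
  | succ s ih =>
    rw [← add_assoc, exec_succ, funext ih]
    refine (DSM.identified_δ'_toState _ _).trans (congrArg DSM.Labelled.toState ?_)
    refine (if_neg (by simp)).trans ((if_neg (by simp)).trans ?_)
    exact simulate_gather A hG pn hσ (x := fun v => ⟨2 * Δ + 3, deg G v,
      label pn Δ (2 * Δ + 2) v, chosenIds pn Δ v, exec A G hG (pn.permute σ) (s + 1) v⟩)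
      (fun _ => rfl) (fun _ => rfl) u

theorem VV.sv {P : GraphProblem Y} (h : VV P) : SV P := by
  obtain ⟨A, T, h⟩ := h
  refine ⟨fun Δ => (A Δ).identified, fun Δ => (A Δ).inSet_identified,
    fun Δ n => 2 * Δ + 3 + T Δ n, fun Δ n G hG pn => ?_⟩
  obtain ⟨σ, hσ⟩ := exists_chosenIds_eq hG pn
  obtain ⟨S, hS, hu⟩ := h Δ n G hG (pn.permute σ)
  refine ⟨S, hS, fun u => ?_⟩
  rw [exec_identified_add (A Δ) hG pn hσ, DSM.Labelled.toState,
    exec_eq_inl_of_le _ hG _ (Nat.le_succ _) (hu u), if_neg (by simp)]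
  rfl

end SetSimulation

theorem SV.mv {Y : Type} {P : GraphProblem Y} (h : SV P) : MV P :=
  let ⟨A, hA, h⟩ := h
  ⟨A, fun Δ => (hA Δ).inMultiset, h⟩

theorem MV.vv {Y : Type} {P : GraphProblem Y} (h : MV P) : VV P :=
  let ⟨A, _, h⟩ := h
  ⟨A, h⟩

/-- The linear order SB ⊊ MB = VB ⊊ SV = MV = VV ⊊ VVc. -/
theorem linear_order :
    (∀ (Y : Type) [Fintype Y] (P : GraphProblem Y), SB P → MB P) ∧
    (∃ (Y : Type) (_ : Fintype Y) (P : GraphProblem Y), MB P ∧ ¬ SB P) ∧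
    (∀ (Y : Type) [Fintype Y] (P : GraphProblem Y), MB P ↔ VB P) ∧
    (∀ (Y : Type) [Fintype Y] (P : GraphProblem Y), VB P → SV P) ∧
    (∃ (Y : Type) (_ : Fintype Y) (P : GraphProblem Y), SV P ∧ ¬ VB P) ∧
    (∀ (Y : Type) [Fintype Y] (P : GraphProblem Y), (SV P ↔ MV P) ∧ (MV P ↔ VV P)) ∧
    (∀ (Y : Type) [Fintype Y] (P : GraphProblem Y), VV P → VVc P) ∧
    (∃ (Y : Type) (_ : Fintype Y) (P : GraphProblem Y), VVc P ∧ ¬ VV P) := by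
  refine ⟨fun Y _ P => ?_, ⟨Bool, inferInstance, twoLeaves, mb_twoLeaves, not_sb_twoLeaves⟩,
    fun Y _ P => ⟨?_, VB.mb⟩, fun Y _ P h => VV.sv ?_,
    ⟨Bool, inferInstance, electLeaf, sv_electLeaf, not_vb_electLeaf⟩,
    fun Y _ P => ⟨⟨SV.mv, fun h => VV.sv h.vv⟩, ⟨MV.vv, fun h => h.sv.mv⟩⟩,
    fun Y _ P => ?_,
    ⟨Fin 3 → Fin 3, inferInstance, breakCubicSymmetry, vvc_breakCubicSymmetry,
      not_vv_breakCubicSymmetry⟩⟩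
  · rintro ⟨A, hA, h⟩
    exact ⟨A, fun Δ => ⟨(hA Δ).1.inMultiset, (hA Δ).2⟩, h⟩
  · rintro ⟨A, hA, h⟩
    exact ⟨A, fun Δ => (hA Δ).2, h⟩
  · obtain ⟨A, -, h⟩ := h
    exact ⟨A, h⟩
  · rintro ⟨A, T, h⟩
    exact ⟨A, T, fun Δ n G hG pn _ => h Δ n G hG pn⟩
end Weak
end

section
/- If G is a k-regular graph for an odd k, and there is a consistent port numbering p of G such that all nodes of G are bisimilar in the Kripke model K_{+,+}(G,p), then G has a 1-factor. -/
namespace Weak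

/-- A Kripke model with accessibility relations indexed by I and propositions Φ. -/
structure KripkeModel (I : Type) (Φ : Type) where
  W : Type
  R : I → W → W → Prop
  val : Φ → W → Prop

/-- Bisimulation between two Kripke models. -/
def IsBisimulation {I Φ : Type} (K K' : KripkeModel I Φ) (Z : K.W → K'.W → Prop) : Prop :=
  (∃ v v', Z v v') ∧
  (∀ v v', Z v v' → ∀ q, (K.val q v ↔ K'.val q v')) ∧
  (∀ (α : I) (v w) (v'), Z v v' → K.R α v w → ∃ w', K'.R α v' w' ∧ Z w w') ∧
  (∀ (α : I) (v v' w'), Z v v' → K'.R α v' w' → ∃ w, K.R α v w ∧ Z w w')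

/-- Two states are bisimilar if some bisimulation relates them. -/
def Bisimilar {I Φ : Type} (K K' : KripkeModel I Φ) (v : K.W) (v' : K'.W) : Prop :=
  ∃ Z, IsBisimulation K K' Z ∧ Z v v'

/-- The Kripke model K_{+,+}(G,p): relations R_{(i,j)}, valuation by degree. -/
def KPP {n : ℕ} (Δ : ℕ) (G : SimpleGraph (Fin n)) (pn : PortNumbering G) :
    KripkeModel (Fin Δ × Fin Δ) (Fin Δ) where
  W := Fin n
  R := fun α u v => ∃ hj : (α.2 : ℕ) < deg G v,
        (pn.p ⟨v, ⟨(α.2 : ℕ), hj⟩⟩).1 = u ∧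
        ((pn.p ⟨v, ⟨(α.2 : ℕ), hj⟩⟩).2 : ℕ) = (α.1 : ℕ)
  val := fun q v => deg G v = (q : ℕ) + 1

/-- The Kripke model K_{−,+}(G,p): relations R_{(*,j)}. -/
def KMP {n : ℕ} (Δ : ℕ) (G : SimpleGraph (Fin n)) (pn : PortNumbering G) :
    KripkeModel (Fin Δ) (Fin Δ) where
  W := Fin n
  R := fun j u v => ∃ hj : (j : ℕ) < deg G v, (pn.p ⟨v, ⟨(j : ℕ), hj⟩⟩).1 = u
  val := fun q v => deg G v = (q : ℕ) + 1

/-- The Kripke model K_{+,−}(G,p): relations R_{(i,*)}. -/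
def KPM {n : ℕ} (Δ : ℕ) (G : SimpleGraph (Fin n)) (pn : PortNumbering G) :
    KripkeModel (Fin Δ) (Fin Δ) where
  W := Fin n
  R := fun i u v => ∃ j : Fin (deg G v),
        (pn.p ⟨v, j⟩).1 = u ∧ ((pn.p ⟨v, j⟩).2 : ℕ) = (i : ℕ)
  val := fun q v => deg G v = (q : ℕ) + 1

/-- The Kripke model K_{−,−}(G,p): the single relation R_{(*,*)}. -/
def KMM {n : ℕ} (Δ : ℕ) (G : SimpleGraph (Fin n)) (pn : PortNumbering G) :
    KripkeModel Unit (Fin Δ) where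
  W := Fin n
  R := fun _ u v => ∃ j : Fin (deg G v), (pn.p ⟨v, j⟩).1 = u
  val := fun q v => deg G v = (q : ℕ) + 1

/-- Formulas of multimodal logic MML(I,Φ); with I = Unit this is basic modal logic ML(Φ). -/
inductive MFormula (I : Type) (Φ : Type) : Type
  | prop : Φ → MFormula I Φ
  | and : MFormula I Φ → MFormula I Φ → MFormula I Φ
  | not : MFormula I Φ → MFormula I Φ
  | dia : I → MFormula I Φ → MFormula I Φ

/-- Truth of an MML formula at a state of a Kripke model. -/
def MSat {I Φ : Type} (K : KripkeModel I Φ) : MFormula I Φ → K.W → Prop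
  | MFormula.prop q, v => K.val q v
  | MFormula.and φ ψ, v => MSat K φ v ∧ MSat K ψ v
  | MFormula.not φ, v => ¬ MSat K φ v
  | MFormula.dia α φ, v => ∃ w, K.R α v w ∧ MSat K φ w

/-- Formulas of graded multimodal logic GMML(I,Φ); with I = Unit this is GML(Φ). -/
inductive GFormula (I : Type) (Φ : Type) : Type
  | prop : Φ → GFormula I Φ
  | and : GFormula I Φ → GFormula I Φ → GFormula I Φ
  | not : GFormula I Φ → GFormula I Φ
  | dia : I → GFormula I Φ → GFormula I Φ
  | gdia : I → ℕ → GFormula I Φ → GFormula I Φ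

/-- Truth of a GMML formula at a state of a Kripke model. -/
def GSat {I Φ : Type} (K : KripkeModel I Φ) : GFormula I Φ → K.W → Prop
  | GFormula.prop q, v => K.val q v
  | GFormula.and φ ψ, v => GSat K φ v ∧ GSat K ψ v
  | GFormula.not φ, v => ¬ GSat K φ v
  | GFormula.dia α φ, v => ∃ w, K.R α v w ∧ GSat K φ w
  | GFormula.gdia α k φ, v => k ≤ Nat.card {w : K.W // K.R α v w ∧ GSat K φ w}

end Weak
namespace Weak

/-- In a `k`-regular graph, port `i` of `v`, with `i : Fin k`. -/
noncomputable def regularPort {n k : ℕ} {G : SimpleGraph (Fin n)} (hreg : ∀ v, deg G v = k)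
    (v : Fin n) (i : Fin k) : Port G :=
  ⟨v, Fin.cast (hreg v).symm i⟩

theorem regularPort_inj {n k : ℕ} {G : SimpleGraph (Fin n)} (hreg : ∀ v, deg G v = k)
    {u v : Fin n} {i j : Fin k} :
    regularPort hreg u i = regularPort hreg v j ↔ u = v ∧ i = j := by
  refine ⟨fun h => ?_, by rintro ⟨rfl, rfl⟩; rfl⟩
  obtain rfl : u = v := congrArg Sigma.fst h
  simpa [regularPort] using h

theorem exists_eq_regularPort {n k : ℕ} {G : SimpleGraph (Fin n)} (hreg : ∀ v, deg G v = k)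
    (q : Port G) : ∃ v i, q = regularPort hreg v i :=
  ⟨q.1, Fin.cast (hreg q.1) q.2, rfl⟩

theorem KPP_R_iff {n k : ℕ} {G : SimpleGraph (Fin n)} (hreg : ∀ v, deg G v = k)
    (pn : PortNumbering G) (i j : Fin k) (u v : Fin n) :
    (KPP k G pn).R (i, j) u v ↔ pn.p (regularPort hreg v j) = regularPort hreg u i := by
  constructor
  · rintro ⟨hj, rfl, h⟩
    exact Sigma.ext rfl (heq_of_eq (Fin.ext h))
  · intro h
    have hj : (j : ℕ) < deg G v := (hreg v).symm ▸ j.isLt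
    change pn.p ⟨v, ⟨j, hj⟩⟩ = _ at h
    refine ⟨hj, ?_⟩
    change (pn.p ⟨v, ⟨j, hj⟩⟩).1 = u ∧ ((pn.p ⟨v, ⟨j, hj⟩⟩).2 : ℕ) = i
    rw [h]
    exact ⟨rfl, rfl⟩

/-- An involution of a finite set of odd cardinality has a fixed point. -/
theorem exists_fixed_point_of_involutive {k : ℕ} (hk : Odd k) {f : Fin k → Fin k}
    (hf : Function.Involutive f) : ∃ i, f i = i := by
  have : ¬ 2 ∣ Fintype.card (Fin k) := by
    rwa [Fintype.card_fin, ← even_iff_two_dvd, Nat.not_even_iff_odd]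
  exact Equiv.Perm.exists_fixed_point_of_prime (n := 1) this (σ := hf.toPerm)
    (Equiv.ext fun i => by simpa [pow_two] using hf i)

theorem Bisimilar.exists_port_eq {n k : ℕ} {G : SimpleGraph (Fin n)}
    (hreg : ∀ v, deg G v = k) {pn : PortNumbering G} (hc : pn.Consistent) {u v w : Fin n}
    {i j : Fin k} (h : Bisimilar (KPP k G pn) (KPP k G pn) u v)
    (hu : pn.p (regularPort hreg u i) = regularPort hreg w j) :
    ∃ x, pn.p (regularPort hreg v i) = regularPort hreg x j := by
  obtain ⟨Z, ⟨-, -, hforth, -⟩, hZ⟩ := h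
  obtain ⟨x, hx, -⟩ := hforth (i, j) u w v hZ ((KPP_R_iff hreg pn i j u w).2 (by rw [← hu, hc]))
  exact ⟨x, by rw [← (KPP_R_iff hreg pn i j v x).1 hx, hc]⟩

/-- Lemma: if a k-regular graph (k odd) has a consistent port numbering making all
nodes bisimilar in K_{+,+}(G,p), then it has a 1-factor. -/
theorem consistent_bisimilar_one_factor {n : ℕ} (k : ℕ) (hk : Odd k)
    (G : SimpleGraph (Fin n)) (hreg : ∀ v, deg G v = k)
    (pn : PortNumbering G) (hc : pn.Consistent)
    (hbis : ∀ u v : Fin n, Bisimilar (KPP k G pn) (KPP k G pn) u v) :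
    ∃ F : SimpleGraph (Fin n), F ≤ G ∧ ∀ v : Fin n, ∃! u : Fin n, F.Adj v u := by
  rcases isEmpty_or_nonempty (Fin n) with hn | ⟨⟨v₀⟩⟩
  · exact ⟨G, le_rfl, fun v => hn.elim v⟩
  have hport : ∀ i, ∃ j, ∀ v, ∃ x, pn.p (regularPort hreg v i) = regularPort hreg x j := by
    intro i
    obtain ⟨w, j, hw⟩ := exists_eq_regularPort hreg (pn.p (regularPort hreg v₀ i))
    exact ⟨j, fun v => (hbis v₀ v).exists_port_eq hreg hc hw⟩
  choose f hf using hport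
  have hinv : Function.Involutive f := by
    intro i
    obtain ⟨w, hw⟩ := hf i v₀
    obtain ⟨x, hx⟩ := hf (f i) w
    rw [← hw, hc, regularPort_inj] at hx
    exact hx.2.symm
  obtain ⟨i, hi⟩ := exists_fixed_point_of_involutive hk hinv
  have hadj : ∀ {u v}, pn.p (regularPort hreg u i) = regularPort hreg v i → G.Adj u v :=
    fun {u v} h => (pn.adj u v).1 ⟨_, congrArg Sigma.fst h⟩
  let F : SimpleGraph (Fin n) :=
    { Adj := fun u v => pn.p (regularPort hreg u i) = regularPort hreg v i
      symm := ⟨fun u v h => by rw [← h, hc]⟩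
      loopless := ⟨fun u h => (hadj h).ne rfl⟩ }
  refine ⟨F, fun u v h => hadj h, fun v => ?_⟩
  obtain ⟨x, hx⟩ := hf i v
  rw [hi] at hx
  exact ⟨x, hx, fun y hy => ((regularPort_inj hreg).1 (Eq.trans (Eq.symm hy) hx)).1⟩

end Weak
end
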